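/- Fix n, m ∈ ℕ with m ≤ n. Let M, M̂ : ℝⁿ → (real symmetric positive definite n×n matrices) be continuously differentiable, V̂ : ℝⁿ → ℝ continuously differentiable, G : ℝⁿ → (real n×m matrices), Kᵥ : ℝⁿ → (real symmetric positive semidefinite m×m matrices), and C : ℝⁿ → (trilinear maps on ℝⁿ) with C(q)(u,v,w) = C(q)(v,u,w) and C(q)(u,v,w) + C(q)(v,w,u) + C(q)(w,u,v) = 0 for all q ∈ ℝⁿ and u,v,w ∈ ℝⁿ. Define Ĥ(q,p) = (1/2) pᵀ M̂(q)⁻¹ p + V̂(q). Suppose q, p : ℝ → ℝⁿ are differentiable curves satisfying, for all t, q′(t) = M(q(t))⁻¹ M̂(q(t)) ∂ₚĤ(q(t),p(t)) and p′(t) = −M̂(q(t)) M(q(t))⁻¹ ∂_qĤ(q(t),p(t)) − G(q(t)) Kᵥ(q(t)) G(q(t))ᵀ ∂ₚĤ(q(t),p(t)) + F(q(t),p(t)), where F(q,p) ∈ ℝⁿ has k-th component C(q)(M̂(q)⁻¹p, M̂(q)⁻¹p, e_k). Then for every t, the function s ↦ Ĥ(q(s),p(s)) has derivative at t equal to −(G(q(t))ᵀ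 M̂(q(t))⁻¹ p(t))ᵀ Kᵥ(q(t)) (G(q(t))ᵀ M̂(q(t))⁻¹ p(t)), which is ≤ 0; in particular t ↦ Ĥ(q(t),p(t)) is nonincreasing. -/

import Mathlib

open Matrix

/-- The desired Hamiltonian `Ĥ(q,p) = (1/2) pᵀ M̂(q)⁻¹ p + V̂(q)`. -/
noncomputable def Hhat (n : ℕ) (Mhat : (Fin n → ℝ) → Matrix (Fin n) (Fin n) ℝ)
    (Vhat : (Fin n → ℝ) → ℝ) (q p : Fin n → ℝ) : ℝ :=
  (1 / 2) * (p ⬝ᵥ ((Mhat q)⁻¹ *ᵥ p)) + Vhat q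

/-- The gradient `∂_q Ĥ(q,p)` of the desired Hamiltonian with respect to `q`. -/
noncomputable def gradQ (n : ℕ) (Mhat : (Fin n → ℝ) → Matrix (Fin n) (Fin n) ℝ)
    (Vhat : (Fin n → ℝ) → ℝ) (q p : Fin n → ℝ) : Fin n → ℝ :=
  fun k => fderiv ℝ (fun q' => Hhat n Mhat Vhat q' p) q (Pi.single k 1)

/-- The gradient `∂_p Ĥ(q,p)` of the desired Hamiltonian with respect to `p`. -/
noncomputable def gradP (n : ℕ) (Mhat : (Fin n → ℝ) → Matrix (Fin n) (Fin n) ℝ)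
    (Vhat : (Fin n → ℝ) → ℝ) (q p : Fin n → ℝ) : Fin n → ℝ :=
  fun k => fderiv ℝ (fun p' => Hhat n Mhat Vhat q p') p (Pi.single k 1)

/-- The determinant of a matrix of differentiable functions is differentiable. -/
lemma differentiableAt_det {E : Type*} [NormedAddCommGroup E] [NormedSpace ℝ E] {n : ℕ}
    {A : E → Matrix (Fin n) (Fin n) ℝ} {x : E}
    (hA : ∀ i j, DifferentiableAt ℝ (fun y => A y i j) x) :
    DifferentiableAt ℝ (fun y => (A y).det) x := by
  simp only [Matrix.det_apply]
  fun_prop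

/-- The entries of the inverse of an invertible matrix of differentiable functions are
differentiable. -/
lemma differentiableAt_inv_entry {E : Type*} [NormedAddCommGroup E] [NormedSpace ℝ E] {n : ℕ}
    {A : E → Matrix (Fin n) (Fin n) ℝ} {x : E}
    (hA : ∀ i j, DifferentiableAt ℝ (fun y => A y i j) x) (hdet : (A x).det ≠ 0)
    (i j : Fin n) : DifferentiableAt ℝ (fun y => (A y)⁻¹ i j) x := by
  simp only [Matrix.inv_def, Matrix.smul_apply, Ring.inverse_eq_inv', smul_eq_mul,
    Matrix.adjugate_apply]
  refine ((differentiableAt_det hA).inv hdet).mul (differentiableAt_det fun k l => ?_)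
  by_cases h : k = j
  · subst h
    simp only [Matrix.updateRow_self]
    fun_prop
  · simpa only [Matrix.updateRow_ne h] using hA k l

/-- The desired Hamiltonian is jointly differentiable in position and momentum. -/
lemma differentiableAt_Hhat {n : ℕ} {Mhat : (Fin n → ℝ) → Matrix (Fin n) (Fin n) ℝ}
    {Vhat : (Fin n → ℝ) → ℝ} {q p : Fin n → ℝ} (hdet : (Mhat q).det ≠ 0)
    (hM : ∀ i j, DifferentiableAt ℝ (fun q' => Mhat q' i j) q)
    (hV : DifferentiableAt ℝ Vhat q) :
    DifferentiableAt ℝ (fun x : (Fin n → ℝ) × (Fin n → ℝ) => Hhat n Mhat Vhat x.1 x.2)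
      (q, p) := by
  have hinv : ∀ i j, DifferentiableAt ℝ
      (fun x : (Fin n → ℝ) × (Fin n → ℝ) => (Mhat x.1)⁻¹ i j) (q, p) := fun i j =>
    DifferentiableAt.comp (g := fun q' => (Mhat q')⁻¹ i j) (q, p)
      (differentiableAt_inv_entry hM hdet i j) differentiableAt_fst
  have hVfst : DifferentiableAt ℝ
      (fun x : (Fin n → ℝ) × (Fin n → ℝ) => Vhat x.1) (q, p) :=
    DifferentiableAt.comp (g := Vhat) (q, p) hV differentiableAt_fst
  have hp : ∀ i, DifferentiableAt ℝ (fun x : (Fin n → ℝ) × (Fin n → ℝ) => x.2 i) (q, p) :=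
    fun i => by fun_prop
  have hquad : DifferentiableAt ℝ (fun x : (Fin n → ℝ) × (Fin n → ℝ) =>
      ∑ i, x.2 i * ∑ j, (Mhat x.1)⁻¹ i j * x.2 j) (q, p) :=
    DifferentiableAt.fun_sum fun i _ => (hp i).mul
      (DifferentiableAt.fun_sum fun j _ => (hinv i j).mul (hp j))
  exact (hquad.const_mul (1 / 2)).add hVfst

/-- A linear functional is the dot product with its values on the standard basis. -/
lemma clm_eq_dotProduct {n : ℕ} (L : (Fin n → ℝ) →L[ℝ] ℝ) (v : Fin n → ℝ) :
    L v = v ⬝ᵥ fun k => L (Pi.single k 1) := by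
  conv_lhs => rw [pi_eq_sum_univ' v]
  simp [dotProduct]

/-- Chain rule for the desired Hamiltonian along a differentiable curve. -/
lemma hasDerivAt_Hhat {n : ℕ} {Mhat : (Fin n → ℝ) → Matrix (Fin n) (Fin n) ℝ}
    {Vhat : (Fin n → ℝ) → ℝ} {q p : ℝ → Fin n → ℝ} {q' p' : Fin n → ℝ} {t : ℝ}
    (hdiff : DifferentiableAt ℝ
      (fun x : (Fin n → ℝ) × (Fin n → ℝ) => Hhat n Mhat Vhat x.1 x.2) (q t, p t))
    (hq : HasDerivAt q q' t) (hp : HasDerivAt p p' t) :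
    HasDerivAt (fun s => Hhat n Mhat Vhat (q s) (p s))
      (q' ⬝ᵥ gradQ n Mhat Vhat (q t) (p t) + p' ⬝ᵥ gradP n Mhat Vhat (q t) (p t)) t := by
  have hL := hdiff.hasFDerivAt
  set L := fderiv ℝ
    (fun x : (Fin n → ℝ) × (Fin n → ℝ) => Hhat n Mhat Vhat x.1 x.2) (q t, p t)
  have h1 : HasFDerivAt (fun y => Hhat n Mhat Vhat y (p t))
      (L.comp (ContinuousLinearMap.inl ℝ _ _)) (q t) :=
    HasFDerivAt.comp (f := fun y => (y, p t)) (q t) hL (hasFDerivAt_prodMk_left (q t) (p t))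
  have h2 : HasFDerivAt (fun y => Hhat n Mhat Vhat (q t) y)
      (L.comp (ContinuousLinearMap.inr ℝ _ _)) (p t) :=
    HasFDerivAt.comp (f := fun y => (q t, y)) (p t) hL (hasFDerivAt_prodMk_right (q t) (p t))
  have h := hL.comp_hasDerivAt t (hq.prodMk hp)
  have hsplit : L (q', p') =
      q' ⬝ᵥ gradQ n Mhat Vhat (q t) (p t) + p' ⬝ᵥ gradP n Mhat Vhat (q t) (p t) := by
    unfold gradQ gradP
    rw [h1.fderiv, h2.fderiv, ← clm_eq_dotProduct, ← clm_eq_dotProduct]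
    simp [← map_add]
  rw [← hsplit]
  exact h

/-- The momentum gradient of the desired Hamiltonian is `M̂⁻¹ p`. -/
lemma gradP_eq {n : ℕ} {Mhat : (Fin n → ℝ) → Matrix (Fin n) (Fin n) ℝ}
    (Vhat : (Fin n → ℝ) → ℝ) (q p : Fin n → ℝ) (hsym : (Mhat q).IsSymm) :
    gradP n Mhat Vhat q p = (Mhat q)⁻¹ *ᵥ p := by
  have hA : ((Mhat q)⁻¹)ᵀ = (Mhat q)⁻¹ := by rw [Matrix.transpose_nonsing_inv, hsym.eq]
  set A := (Mhat q)⁻¹ with hAdef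
  have hdiff : DifferentiableAt ℝ (fun p' => Hhat n Mhat Vhat q p') p := by
    simp only [Hhat, dotProduct, Matrix.mulVec]
    fun_prop
  funext k
  have hline : HasDerivAt (fun s : ℝ => p + s • (Pi.single k 1 : Fin n → ℝ))
      (Pi.single k 1) 0 := by
    simpa using ((hasDerivAt_id (0 : ℝ)).smul_const (Pi.single k 1 : Fin n → ℝ)).const_add p
  have h1 := HasFDerivAt.comp_hasDerivAt_of_eq (0 : ℝ) hdiff.hasFDerivAt hline (by simp)
  have hcross : p ⬝ᵥ (A *ᵥ Pi.single k 1) = (A *ᵥ p) k := by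
    rw [Matrix.dotProduct_mulVec, ← Matrix.mulVec_transpose, hA, dotProduct_single_one]
  have hexp : (fun s : ℝ => Hhat n Mhat Vhat q (p + s • (Pi.single k 1 : Fin n → ℝ))) =
      fun s => (1 / 2) * (p ⬝ᵥ (A *ᵥ p) + s * (2 * (A *ᵥ p) k) + s ^ 2 * A k k)
        + Vhat q := by
    funext s
    simp only [Hhat, ← hAdef, Matrix.mulVec_add, Matrix.mulVec_smul, add_dotProduct,
      dotProduct_add, smul_dotProduct, dotProduct_smul, hcross, single_one_dotProduct,
      smul_eq_mul]
    simp
    ring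
  have h2 : HasDerivAt
      (fun s : ℝ => (1 / 2) * (p ⬝ᵥ (A *ᵥ p) + s * (2 * (A *ᵥ p) k) + s ^ 2 * A k k)
        + Vhat q) ((A *ᵥ p) k) 0 := by
    have h := (((((hasDerivAt_id (0 : ℝ)).mul_const (2 * (A *ᵥ p) k)).const_add
      (p ⬝ᵥ (A *ᵥ p))).add (((hasDerivAt_id (0 : ℝ)).pow 2).mul_const (A k k))).const_mul
      (1 / 2)).add_const (Vhat q)
    refine h.congr_deriv ?_
    simp
  rw [← hexp] at h2
  exact h1.unique h2

/-- A quadratic gyroscopic force does no work. -/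
lemma gyroscopic_power_eq_zero {n : ℕ}
    {C : (Fin n → ℝ) →ₗ[ℝ] (Fin n → ℝ) →ₗ[ℝ] (Fin n → ℝ) →ₗ[ℝ] ℝ}
    (hcyc : ∀ u v w, C u v w + C v w u + C w u v = 0) (v : Fin n → ℝ) :
    (fun k => C v v (Pi.single k 1)) ⬝ᵥ v = 0 := by
  have h := clm_eq_dotProduct (LinearMap.toContinuousLinearMap (C v v)) v
  rw [LinearMap.coe_toContinuousLinearMap'] at h
  rw [dotProduct_comm, ← h]
  linarith [hcyc v v v]

/-- Along any solution `(q(t), p(t))` of the desired IDA-PBC closed-loop equations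
`q′ = M⁻¹ M̂ ∂ₚĤ`, `p′ = −M̂ M⁻¹ ∂_qĤ − G Kᵥ Gᵀ ∂ₚĤ + F_gyro`, with `M`, `M̂`
symmetric positive definite and `C¹`, `V̂` `C¹`, `Kᵥ` symmetric positive semidefinite,
and `C(q)` a gyroscopic tensor field (symmetric in its first two arguments, vanishing
cyclic sums) inducing the quadratic gyroscopic force `F_gyro`, the desired Hamiltonian
decreases: `d/dt Ĥ(q(t),p(t)) = −(GᵀM̂⁻¹p)ᵀ Kᵥ (GᵀM̂⁻¹p) ≤ 0`, so `t ↦ Ĥ(q(t),p(t))`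
is nonincreasing. -/
theorem stmt_12 (n m : ℕ) (hmn : m ≤ n)
    (M Mhat : (Fin n → ℝ) → Matrix (Fin n) (Fin n) ℝ)
    (hMpos : ∀ q, (M q).PosDef) (hMsym : ∀ q, (M q).IsSymm)
    (hMhatpos : ∀ q, (Mhat q).PosDef) (hMhatsym : ∀ q, (Mhat q).IsSymm)
    (hMC1 : ∀ i j, ContDiff ℝ 1 fun q => M q i j)
    (hMhatC1 : ∀ i j, ContDiff ℝ 1 fun q => Mhat q i j)
    (Vhat : (Fin n → ℝ) → ℝ) (hVhatC1 : ContDiff ℝ 1 Vhat)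
    (G : (Fin n → ℝ) → Matrix (Fin n) (Fin m) ℝ)
    (Kv : (Fin n → ℝ) → Matrix (Fin m) (Fin m) ℝ)
    (hKv : ∀ q, (Kv q).PosSemidef) (hKvsym : ∀ q, (Kv q).IsSymm)
    (C : (Fin n → ℝ) → (Fin n → ℝ) →ₗ[ℝ] (Fin n → ℝ) →ₗ[ℝ] (Fin n → ℝ) →ₗ[ℝ] ℝ)
    (hCsym : ∀ q u v w, C q u v w = C q v u w)
    (hCcyc : ∀ q u v w, C q u v w + C q v w u + C q w u v = 0)
    (q p : ℝ → Fin n → ℝ)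
    (hq : ∀ t, HasDerivAt q
      (((M (q t))⁻¹ * Mhat (q t)) *ᵥ gradP n Mhat Vhat (q t) (p t)) t)
    (hp : ∀ t, HasDerivAt p
      (-((Mhat (q t) * (M (q t))⁻¹) *ᵥ gradQ n Mhat Vhat (q t) (p t))
        - (G (q t) * Kv (q t) * (G (q t))ᵀ) *ᵥ gradP n Mhat Vhat (q t) (p t)
        + fun k => C (q t) ((Mhat (q t))⁻¹ *ᵥ p t) ((Mhat (q t))⁻¹ *ᵥ p t)
            (Pi.single k 1)) t) :
    ∀ t : ℝ,
      HasDerivAt (fun s => Hhat n Mhat Vhat (q s) (p s))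
        (-(((G (q t))ᵀ *ᵥ ((Mhat (q t))⁻¹ *ᵥ p t)) ⬝ᵥ
            (Kv (q t) *ᵥ ((G (q t))ᵀ *ᵥ ((Mhat (q t))⁻¹ *ᵥ p t))))) t ∧
      -(((G (q t))ᵀ *ᵥ ((Mhat (q t))⁻¹ *ᵥ p t)) ⬝ᵥ
          (Kv (q t) *ᵥ ((G (q t))ᵀ *ᵥ ((Mhat (q t))⁻¹ *ᵥ p t)))) ≤ 0 ∧
      Antitone (fun s => Hhat n Mhat Vhat (q s) (p s)) := by
  have hderiv : ∀ t : ℝ, HasDerivAt (fun s => Hhat n Mhat Vhat (q s) (p s))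
      (-(((G (q t))ᵀ *ᵥ ((Mhat (q t))⁻¹ *ᵥ p t)) ⬝ᵥ
        (Kv (q t) *ᵥ ((G (q t))ᵀ *ᵥ ((Mhat (q t))⁻¹ *ᵥ p t))))) t := by
    intro t
    have hdiff := differentiableAt_Hhat (p := p t) (hMhatpos (q t)).det_pos.ne'
      (fun i j => (hMhatC1 i j).differentiable one_ne_zero (q t))
      (hVhatC1.differentiable one_ne_zero (q t))
    have h := hasDerivAt_Hhat hdiff (hq t) (hp t)
    rw [gradP_eq Vhat (q t) (p t) (hMhatsym (q t))] at h
    convert h using 1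
    have hT : ((M (q t))⁻¹ * Mhat (q t))ᵀ = Mhat (q t) * (M (q t))⁻¹ := by
      rw [Matrix.transpose_mul, Matrix.transpose_nonsing_inv, (hMsym (q t)).eq,
        (hMhatsym (q t)).eq]
    set v := (Mhat (q t))⁻¹ *ᵥ p t
    have hcancel : (((M (q t))⁻¹ * Mhat (q t)) *ᵥ v) ⬝ᵥ gradQ n Mhat Vhat (q t) (p t) =
        ((Mhat (q t) * (M (q t))⁻¹) *ᵥ gradQ n Mhat Vhat (q t) (p t)) ⬝ᵥ v := by
      rw [← hT, Matrix.mulVec_transpose, ← Matrix.dotProduct_mulVec, dotProduct_comm]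
    have hdamp : ((G (q t) * Kv (q t) * (G (q t))ᵀ) *ᵥ v) ⬝ᵥ v =
        ((G (q t))ᵀ *ᵥ v) ⬝ᵥ (Kv (q t) *ᵥ ((G (q t))ᵀ *ᵥ v)) := by
      rw [← Matrix.mulVec_mulVec, ← Matrix.mulVec_mulVec, dotProduct_comm,
        Matrix.dotProduct_mulVec, ← Matrix.mulVec_transpose]
    rw [add_dotProduct, sub_dotProduct, neg_dotProduct, hcancel, hdamp,
      gyroscopic_power_eq_zero (hCcyc (q t))]
    ring
  have hnonpos : ∀ t : ℝ, -(((G (q t))ᵀ *ᵥ ((Mhat (q t))⁻¹ *ᵥ p t)) ⬝ᵥ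
      (Kv (q t) *ᵥ ((G (q t))ᵀ *ᵥ ((Mhat (q t))⁻¹ *ᵥ p t)))) ≤ 0 := by
    intro t
    have h := (hKv (q t)).dotProduct_mulVec_nonneg ((G (q t))ᵀ *ᵥ ((Mhat (q t))⁻¹ *ᵥ p t))
    rw [star_trivial] at h
    exact neg_nonpos.mpr h
  exact fun t => ⟨hderiv t, hnonpos t, antitone_of_hasDerivAt_nonpos hderiv hnonpos⟩
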